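/- The extended conflict hypergraph compactly represents all repairs (Proposition 4 of the paper, stated with the consistency hypothesis its proof uses): Assume C is finite. For every instance I and every maximal independent set M of the extended conflict hypergraph G(I,C) whose positive projection M⁺ = { p : the fact p occurs positively in M } is consistent, either M⁺ is a repair of I, or there exists a maximal independent set M' of G(I,C) such that Δ(I, M'⁺) ⊊ Δ(I, M⁺), where M'⁺ is the positive projection of M'. -/

import Mathlib

/-!
Setting: facts form a type `F` with decidable equality, instances are finite sets of facts.
`C` is a set of conflicts, each a pair `(P,N)` of finite sets of facts with `P` nonempty
and `P ∩ N = ∅`.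
-/

variable {F : Type*} [DecidableEq F]

/-- An instance `J` is consistent: no conflict `(P,N) ∈ C` has `P ⊆ J` and `N ∩ J = ∅`. -/
def CConsistent (C : Set (Finset F × Finset F)) (J : Finset F) : Prop :=
  ¬ ∃ c ∈ C, c.1 ⊆ J ∧ c.2 ∩ J = ∅

/-- Symmetric difference `Δ(I,J) = (I∖J) ∪ (J∖I)` of two instances. -/
def CDelta (I J : Finset F) : Finset F := (I \ J) ∪ (J \ I)

/-- `I'` is a repair of `I`: a consistent instance such that no consistent instance `J`
satisfies `Δ(I,J) ⊊ Δ(I,I')`. -/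
def CRepair (C : Set (Finset F × Finset F)) (I I' : Finset F) : Prop :=
  CConsistent C I' ∧ ¬ ∃ J : Finset F, CConsistent C J ∧ CDelta I J ⊂ CDelta I I'

/-- A literal: either a fact `p` or a negated fact `¬p`. -/
inductive DBLit (F : Type*) where
  | pos : F → DBLit F
  | neg : F → DBLit F

/-- The hull `Hull(I,C)`: the least set of literals containing every fact of `I`
(positively) and such that for every conflict `(P,N) ∈ C` all of whose positive facts
are in the hull, every `q ∈ N` has both `q` and `¬q` in the hull. -/
inductive InHull (C : Set (Finset F × Finset F)) (I : Finset F) : DBLit F → Prop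
  | base {p : F} (hp : p ∈ I) : InHull C I (DBLit.pos p)
  | stepPos {c : Finset F × Finset F} {q : F} (hc : c ∈ C)
      (hall : ∀ p ∈ c.1, InHull C I (DBLit.pos p)) (hq : q ∈ c.2) :
      InHull C I (DBLit.pos q)
  | stepNeg {c : Finset F × Finset F} {q : F} (hc : c ∈ C)
      (hall : ∀ p ∈ c.1, InHull C I (DBLit.pos p)) (hq : q ∈ c.2) :
      InHull C I (DBLit.neg q)

/-- Hyperedges of the extended conflict hypergraph `G(I,C)`: conflict edges
`P ∪ {¬q : q ∈ N}` for conflicts `(P,N) ∈ C` all of whose literals lie in the hull,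
and stabilizing edges `{q, ¬q}` for facts `q` with both `q` and `¬q` in the hull. -/
def IsEdge (C : Set (Finset F × Finset F)) (I : Finset F) (e : Set (DBLit F)) : Prop :=
  (∃ c ∈ C, e = DBLit.pos '' (↑c.1 : Set F) ∪ DBLit.neg '' (↑c.2 : Set F) ∧
      ∀ l ∈ e, InHull C I l) ∨
  (∃ q : F, InHull C I (DBLit.pos q) ∧ InHull C I (DBLit.neg q) ∧
      e = {DBLit.pos q, DBLit.neg q})

/-- An independent set of `G(I,C)`: a subset of the hull containing no hyperedge. -/
def Indep (C : Set (Finset F × Finset F)) (I : Finset F) (M : Set (DBLit F)) : Prop :=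
  (∀ l ∈ M, InHull C I l) ∧ ∀ e : Set (DBLit F), IsEdge C I e → ¬ e ⊆ M

/-- A maximal independent set of `G(I,C)`: an independent set such that no strictly
larger subset of the hull is independent. -/
def MaxIndep (C : Set (Finset F × Finset F)) (I : Finset F) (M : Set (DBLit F)) : Prop :=
  Indep C I M ∧ ∀ M' : Set (DBLit F), M ⊂ M' → ¬ Indep C I M'

/-- The positive projection `M⁺` of a set of literals. -/
def posProj (M : Set (DBLit F)) : Set F := {p : F | DBLit.pos p ∈ M}

/-- Symmetric difference of two sets of facts. -/
def SDeltaS (X Y : Set F) : Set F := (X \ Y) ∪ (Y \ X)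

/-- Consistency for an arbitrary set of facts. -/
def CConsistentSet (C : Set (Finset F × Finset F)) (J : Set F) : Prop :=
  ¬ ∃ c ∈ C, (↑c.1 : Set F) ⊆ J ∧ (↑c.2 : Set F) ∩ J = ∅

lemma InHull.mem_or_neg_of_pos {C : Set (Finset F × Finset F)} {I : Finset F} {q : F}
    (h : InHull C I (DBLit.pos q)) : q ∈ I ∨ InHull C I (DBLit.neg q) := by
  cases h with
  | base hp => exact .inl hp
  | stepPos hc hall hq => exact .inr (.stepNeg hc hall hq)

lemma finite_setOf_inHull_pos {C : Set (Finset F × Finset F)} (hC : C.Finite) (I : Finset F) :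
    {p : F | InHull C I (DBLit.pos p)}.Finite := by
  refine (I.finite_toSet.union (hC.biUnion fun c _ => c.2.finite_toSet)).subset ?_
  intro p hp
  cases hp with
  | base hp => exact .inl hp
  | stepPos hc hall hq => exact .inr (Set.mem_biUnion hc hq)

lemma coe_CDelta (I J : Finset F) : (↑(CDelta I J) : Set F) = SDeltaS ↑I ↑J := by
  simp [CDelta, SDeltaS]

lemma cConsistentSet_coe {C : Set (Finset F × Finset F)} {J : Finset F} :
    CConsistentSet C ↑J ↔ CConsistent C J := by
  simp only [CConsistentSet, CConsistent, Finset.coe_subset, ← Finset.coe_inter,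
    Finset.coe_eq_empty]

lemma CDelta_insert_ssubset {I J : Finset F} {p : F} (hI : p ∈ I) (hJ : p ∉ J) :
    CDelta I (insert p J) ⊂ CDelta I J := by
  rw [Finset.ssubset_iff_of_subset (by intro x; simp only [CDelta]; grind)]
  exact ⟨p, by simp [CDelta, hI, hJ], by simp [CDelta, hI]⟩

/-- Below any consistent instance there is a repair, with respect to inclusion of `CDelta I`. -/
lemma CConsistent.exists_cRepair {C : Set (Finset F × Finset F)} {J : Finset F}
    (hJ : CConsistent C J) (I : Finset F) : ∃ R, CRepair C I R ∧ CDelta I R ⊆ CDelta I J := by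
  obtain ⟨R, ⟨hR, hRJ⟩, hmin⟩ := (InvImage.wf (CDelta I) wellFounded_lt).has_min
    {R | CConsistent C R ∧ CDelta I R ⊆ CDelta I J} ⟨J, hJ, subset_rfl⟩
  exact ⟨R, ⟨hR, fun ⟨K, hK, hKR⟩ => hmin K ⟨hK, hKR.subset.trans hRJ⟩ hKR⟩, hRJ⟩

/-- The literals of the hull that hold in the instance `J`, when the facts of `J` are in the
hull: the facts of `J` and the negations of the other facts. -/
def hullLiterals (C : Set (Finset F × Finset F)) (I J : Finset F) : Set (DBLit F) :=
  DBLit.pos '' ↑J ∪ DBLit.neg '' {q | InHull C I (DBLit.neg q) ∧ q ∉ J}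

section hullLiterals

variable {C : Set (Finset F × Finset F)} {I J : Finset F}

@[simp] lemma pos_mem_hullLiterals {p : F} : DBLit.pos p ∈ hullLiterals C I J ↔ p ∈ J := by
  simp [hullLiterals]

@[simp] lemma neg_mem_hullLiterals {q : F} :
    DBLit.neg q ∈ hullLiterals C I J ↔ InHull C I (DBLit.neg q) ∧ q ∉ J := by
  simp [hullLiterals]

@[simp] lemma posProj_hullLiterals : posProj (hullLiterals C I J) = ↑J := by
  ext p
  simp [posProj]

lemma CConsistent.indep_hullLiterals (hJ : CConsistent C J)
    (hull : ∀ p ∈ J, InHull C I (DBLit.pos p)) : Indep C I (hullLiterals C I J) := by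
  refine ⟨?_, ?_⟩
  · rintro (p | q) h
    · exact hull p (pos_mem_hullLiterals.1 h)
    · exact (neg_mem_hullLiterals.1 h).1
  · rintro e (⟨c, hc, rfl, -⟩ | ⟨q, -, -, rfl⟩) he
    · refine hJ ⟨c, hc, fun p hp => ?_, ?_⟩
      · exact pos_mem_hullLiterals.1 (he (.inl ⟨p, hp, rfl⟩))
      · rw [← Finset.disjoint_iff_inter_eq_empty, Finset.disjoint_left]
        exact fun q hq => (neg_mem_hullLiterals.1 (he (.inr ⟨q, hq, rfl⟩))).2
    · simp only [Set.insert_subset_iff, Set.singleton_subset_iff, pos_mem_hullLiterals,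
        neg_mem_hullLiterals] at he
      exact he.2.2 he.1

/-- A repair contained in the hull is the positive projection of a maximal independent set. -/
lemma CRepair.maxIndep_hullLiterals (hJ : CRepair C I J)
    (hull : ∀ p ∈ J, InHull C I (DBLit.pos p)) : MaxIndep C I (hullLiterals C I J) := by
  refine ⟨hJ.1.indep_hullLiterals hull, fun M' hM' hind => ?_⟩
  obtain ⟨l, hl, hlJ⟩ := Set.exists_of_ssubset hM'
  have hsub := hM'.subset
  have stabilizing (q : F) (hq : DBLit.pos q ∈ M') (hq' : DBLit.neg q ∈ M') : False :=
    hind.2 _ (.inr ⟨q, hind.1 _ hq, hind.1 _ hq', rfl⟩) (Set.pair_subset hq hq')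
  rcases l with p | q
  · rw [pos_mem_hullLiterals] at hlJ
    rcases (hind.1 _ hl).mem_or_neg_of_pos with hpI | hneg
    · refine hJ.2 ⟨insert p J, ?_, CDelta_insert_ssubset hpI hlJ⟩
      rintro ⟨c, hc, hP, hN⟩
      have hPM (r : F) (hr : r ∈ c.1) : DBLit.pos r ∈ M' := by
        rcases Finset.mem_insert.1 (hP hr) with rfl | h
        · exact hl
        · exact hsub (pos_mem_hullLiterals.2 h)
      have hNM (q : F) (hq : q ∈ c.2) : DBLit.neg q ∈ M' := by
        refine hsub (neg_mem_hullLiterals.2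
          ⟨.stepNeg hc (fun r hr => hind.1 _ (hPM r hr)) hq, fun h => ?_⟩)
        exact Finset.disjoint_left.1 (Finset.disjoint_iff_inter_eq_empty.2 hN) hq
          (Finset.mem_insert_of_mem h)
      have hedge : DBLit.pos '' (↑c.1 : Set F) ∪ DBLit.neg '' (↑c.2 : Set F) ⊆ M' :=
        Set.union_subset (Set.image_subset_iff.2 hPM) (Set.image_subset_iff.2 hNM)
      exact hind.2 _ (.inl ⟨c, hc, rfl, fun l hl => hind.1 l (hedge hl)⟩) hedge
    · exact stabilizing p hl (hsub (neg_mem_hullLiterals.2 ⟨hneg, hlJ⟩))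
  · refine stabilizing q (hsub (pos_mem_hullLiterals.2 ?_)) hl
    by_contra h
    exact hlJ (neg_mem_hullLiterals.2 ⟨hind.1 _ hl, h⟩)

end hullLiterals

/-- Proposition 4: for `C` finite and every maximal independent set `M` of `G(I,C)`
whose positive projection `M⁺` is consistent, either `M⁺` is a repair of `I`, or some
maximal independent set `M'` satisfies `Δ(I,M'⁺) ⊊ Δ(I,M⁺)`. -/
theorem hypergraph_represents_all_repairs
    (C : Set (Finset F × Finset F))
    (hC : ∀ c ∈ C, c.1.Nonempty ∧ c.1 ∩ c.2 = ∅)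
    (hCfin : C.Finite)
    (I : Finset F) (M : Set (DBLit F)) (hM : MaxIndep C I M)
    (hcons : CConsistentSet C (posProj M)) :
    (∃ I'' : Finset F, (↑I'' : Set F) = posProj M ∧ CRepair C I I'') ∨
    (∃ M' : Set (DBLit F), MaxIndep C I M' ∧
      SDeltaS (↑I : Set F) (posProj M') ⊂ SDeltaS (↑I : Set F) (posProj M)) := by
  obtain ⟨K, hK⟩ := ((finite_setOf_inHull_pos hCfin I).subset
    (fun p hp => hM.1.1 _ hp : posProj M ⊆ _)).exists_finset_coe
  rw [← hK, cConsistentSet_coe] at hcons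
  by_cases hrep : CRepair C I K
  · exact .inl ⟨K, hK, hrep⟩
  · obtain ⟨J, hJ, hJK⟩ : ∃ J, CConsistent C J ∧ CDelta I J ⊂ CDelta I K := by
      by_contra h
      exact hrep ⟨hcons, h⟩
    obtain ⟨R, hR, hRJ⟩ := hJ.exists_cRepair I
    have hRK := hRJ.trans_ssubset hJK
    refine .inr ⟨hullLiterals C I R, hR.maxIndep_hullLiterals fun p hp => ?_, ?_⟩
    · by_cases hpI : p ∈ I
      · exact .base hpI
      · have hpK : p ∈ CDelta I K := hRK.subset (by simp [CDelta, hp, hpI])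
        have : p ∈ (↑K : Set F) := by simpa [CDelta, hpI] using hpK
        rw [hK] at this
        exact hM.1.1 _ this
    · rw [posProj_hullLiterals, ← hK, ← coe_CDelta, ← coe_CDelta]
      exact Finset.coe_ssubset.2 hRK
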